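/- Let n, m ≥ 0 be integers with (n,m) ≠ (0,1), and let T_2 denote the family of partial 2-trees. If T is a minimal (n,m)-universal bound of T_2, then T has property P_{2,1}, i.e., for every pair of adjacent vertices u, v of T and every pair of adjacency types α, β ∈ {1,…,2n+m}, the set N^α(u) ∩ N^β(v) is nonempty. -/

import Mathlib

open SimpleGraph

/-- The involution pairing the label of an arc with the label of the corresponding
reverse arc: for `1 ≤ k ≤ 2n`, the labels `2i` (arc of type `i`) and `2i-1`
(reverse arc of type `i`) are swapped; edge labels `2n+1, …, 2n+m` are fixed. -/
def conjLab (n k : ℕ) : ℕ :=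
  if k ≤ 2 * n then (if k % 2 = 0 then k - 1 else k + 1) else k

/-- An `(n,m)`-graph: a simple underlying graph together with a labelling of each
ordered pair of adjacent vertices by a number in `{1, …, 2n+m}` (`lab u v = α`
means that `v` is an `α`-neighbor of `u`), compatible with reversal. -/
structure NMGraph (n m : ℕ) (V : Type) where
  und : SimpleGraph V
  lab : V → V → ℕ
  lab_mem : ∀ u v, und.Adj u v → 1 ≤ lab u v ∧ lab u v ≤ 2 * n + m
  lab_conj : ∀ u v, und.Adj u v → lab v u = conjLab n (lab u v)

/-- `N^α(u)`, the set of `α`-neighbors of `u`. -/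
def NMGraph.nbr {n m : ℕ} {V : Type} (G : NMGraph n m V) (α : ℕ) (u : V) : Set V :=
  {v | G.und.Adj u v ∧ G.lab u v = α}

/-- `G → H`: existence of a homomorphism of `(n,m)`-graphs, i.e. a vertex map
preserving adjacency together with the type (and direction) of every arc/edge. -/
def NMGraph.HomTo {n m : ℕ} {V W : Type} (G : NMGraph n m V) (H : NMGraph n m W) : Prop :=
  ∃ f : V → W, ∀ u v, G.und.Adj u v →
    H.und.Adj (f u) (f v) ∧ H.lab (f u) (f v) = G.lab u v

/-- The `(n,m)`-chromatic number of an `(n,m)`-graph: the least number of vertices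
of a target of a homomorphism. -/
noncomputable def nmChrom (n m : ℕ) {V : Type} (G : NMGraph n m V) : ℕ :=
  sInf {t | ∃ H : NMGraph n m (Fin t), G.HomTo H}

/-- The 2-tree extension: add a new vertex adjacent to both endpoints of the edge `uv`. -/
def addVertex {N : ℕ} (G : SimpleGraph (Fin N)) (u v : Fin N) : SimpleGraph (Fin (N + 1)) :=
  SimpleGraph.fromRel (fun a b =>
    (∃ a' b', a = Fin.castSucc a' ∧ b = Fin.castSucc b' ∧ G.Adj a' b') ∨
    (a = Fin.last N ∧ (b = Fin.castSucc u ∨ b = Fin.castSucc v)))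

/-- 2-trees: `K₂` is a 2-tree, and adding a new vertex adjacent to the two endpoints
of an existing edge of a 2-tree yields a 2-tree. -/
inductive Is2Tree : (N : ℕ) → SimpleGraph (Fin N) → Prop
  | base : Is2Tree 2 ⊤
  | extend {N : ℕ} {G : SimpleGraph (Fin N)} (u v : Fin N) (huv : G.Adj u v)
      (h : Is2Tree N G) : Is2Tree (N + 1) (addVertex G u v)

/-- A partial 2-tree: a graph isomorphic to a subgraph of some 2-tree. -/
def IsPartial2Tree {V : Type} (G : SimpleGraph V) : Prop :=
  ∃ (N : ℕ) (T : SimpleGraph (Fin N)) (f : G →g T), Is2Tree N T ∧ Function.Injective f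

/-- The subgraph of an `(n,m)`-graph `T` determined by a vertex set `s` and a
spanning collection of edges `H ≤ T.und`, keeping the inherited labels. -/
def NMGraph.restrict {n m : ℕ} {W : Type} (T : NMGraph n m W) (s : Set W)
    (H : SimpleGraph W) (hle : H ≤ T.und) : NMGraph n m {x : W // x ∈ s} where
  und := SimpleGraph.comap Subtype.val H
  lab := fun u v => T.lab u.1 v.1
  lab_mem := fun u v h => T.lab_mem u.1 v.1 (hle h)
  lab_conj := fun u v h => T.lab_conj u.1 v.1 (hle h)

/-- `T` is an `(n,m)`-universal bound of the family `T₂` of partial 2-trees. -/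
def IsUnivBoundT2 (n m : ℕ) {W : Type} (T : NMGraph n m W) : Prop :=
  ∀ (N : ℕ) (G : NMGraph n m (Fin N)), IsPartial2Tree G.und → G.HomTo T

/-- `T` is a minimal `(n,m)`-universal bound of `T₂`: it is a universal bound and
no proper subgraph of `T` is one. -/
def IsMinUnivBoundT2 (n m : ℕ) {W : Type} (T : NMGraph n m W) : Prop :=
  IsUnivBoundT2 n m T ∧
  ∀ (s : Set W) (H : SimpleGraph W) (hle : H ≤ T.und),
    (s ≠ Set.univ ∨ H ≠ T.und) → ¬ IsUnivBoundT2 n m (T.restrict s H hle)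

/-- Property `P_{2,1}`: any two adjacent vertices have a common neighbor of every
prescribed pair of adjacency types. -/
def HasP21 (n m : ℕ) {W : Type} (T : NMGraph n m W) : Prop :=
  ∀ u v : W, T.und.Adj u v → ∀ α β : ℕ,
    1 ≤ α → α ≤ 2 * n + m → 1 ≤ β → β ≤ 2 * n + m →
    (T.nbr α u ∩ T.nbr β v).Nonempty

lemma conjLab_mem {n m k : ℕ} (h₁ : 1 ≤ k) (h₂ : k ≤ 2 * n + m) :
    1 ≤ conjLab n k ∧ conjLab n k ≤ 2 * n + m := by
  unfold conjLab
  split_ifs <;> omega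

lemma conjLab_conjLab {n k : ℕ} (h₁ : 1 ≤ k) : conjLab n (conjLab n k) = k := by
  unfold conjLab
  split_ifs <;> omega

section addVertex

variable {N : ℕ} (G : SimpleGraph (Fin N)) (a b : Fin N)

@[simp]
lemma addVertex_adj_castSucc (x y : Fin N) :
    (addVertex G a b).Adj x.castSucc y.castSucc ↔ G.Adj x y := by
  simp only [addVertex, SimpleGraph.fromRel_adj, ne_eq, Fin.castSucc_inj, Fin.castSucc_ne_last,
    false_and, or_false]
  constructor
  · rintro ⟨-, ⟨x', y', rfl, rfl, h⟩ | ⟨x', y', rfl, rfl, h⟩⟩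
    exacts [h, h.symm]
  · exact fun h => ⟨h.ne, Or.inl ⟨x, y, rfl, rfl, h⟩⟩

@[simp]
lemma addVertex_adj_last_castSucc (y : Fin N) :
    (addVertex G a b).Adj (Fin.last N) y.castSucc ↔ y = a ∨ y = b := by
  simp [addVertex, (Fin.castSucc_ne_last _).symm]

@[simp]
lemma addVertex_adj_castSucc_last (x : Fin N) :
    (addVertex G a b).Adj x.castSucc (Fin.last N) ↔ x = a ∨ x = b := by
  rw [SimpleGraph.adj_comm, addVertex_adj_last_castSucc]

end addVertex

lemma IsPartial2Tree.addVertex {N : ℕ} {G : SimpleGraph (Fin N)} (hG : IsPartial2Tree G)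
    {a b : Fin N} (hab : G.Adj a b) : IsPartial2Tree (addVertex G a b) := by
  obtain ⟨M, T, f, hT, hf⟩ := hG
  refine ⟨M + 1, _, ⟨Fin.lastCases (Fin.last M) (fun x => (f x).castSucc), ?_⟩,
    hT.extend (f a) (f b) (f.map_adj hab), ?_⟩
  · intro x y
    induction x using Fin.lastCases <;> induction y using Fin.lastCases
    · simp
    · simpa using Or.imp (congrArg f) (congrArg f)
    · simpa using Or.imp (congrArg f) (congrArg f)
    · simpa using fun h => f.map_adj h
  · intro x y
    induction x using Fin.lastCases <;> induction y using Fin.lastCases <;>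
      simp [(Fin.castSucc_ne_last _).symm, hf.eq_iff]

namespace NMGraph

variable {n m : ℕ}

/-- Add a new vertex that is an `α`-neighbor of `a` and a `β`-neighbor of `b`. -/
def addNbr {N : ℕ} (G : NMGraph n m (Fin N)) (a b : Fin N) {α β : ℕ}
    (hα : 1 ≤ α ∧ α ≤ 2 * n + m) (hβ : 1 ≤ β ∧ β ≤ 2 * n + m) : NMGraph n m (Fin (N + 1)) where
  und := addVertex G.und a b
  lab := Fin.lastCases
    (Fin.lastCases 0 fun y => conjLab n (if y = a then α else β))
    (fun x => Fin.lastCases (if x = a then α else β) fun y => G.lab x y)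
  lab_mem x y h := by
    have key (z : Fin N) : 1 ≤ (if z = a then α else β) ∧ (if z = a then α else β) ≤ 2 * n + m := by
      split_ifs <;> assumption
    induction x using Fin.lastCases <;> induction y using Fin.lastCases
    · simp at h
    · simpa using conjLab_mem (key _).1 (key _).2
    · simpa using key _
    · simpa using G.lab_mem _ _ (by simpa using h)
  lab_conj x y h := by
    have key (z : Fin N) : 1 ≤ (if z = a then α else β) := by
      split_ifs <;> omega
    induction x using Fin.lastCases <;> induction y using Fin.lastCases
    · simp at h
    · simpa using (conjLab_conjLab (key _)).symm
    · simp
    · simpa using G.lab_conj _ _ (by simpa using h)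

/-- Any set of adjacent pairs of a partial 2-tree can be provided with common neighbors of types
`α`, `β` within a larger partial 2-tree. -/
lemma exists_extension {N : ℕ} (G : NMGraph n m (Fin N)) (hG : IsPartial2Tree G.und) {α β : ℕ}
    (hα : 1 ≤ α ∧ α ≤ 2 * n + m) (hβ : 1 ≤ β ∧ β ≤ 2 * n + m) (s : Finset (Fin N × Fin N)) :
    ∃ (M : ℕ) (G' : NMGraph n m (Fin M)) (ι : Fin N → Fin M), IsPartial2Tree G'.und ∧
      (∀ x y, G.und.Adj x y →
        G'.und.Adj (ι x) (ι y) ∧ G'.lab (ι x) (ι y) = G.lab x y) ∧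
      ∀ p ∈ s, G.und.Adj p.1 p.2 → (G'.nbr α (ι p.1) ∩ G'.nbr β (ι p.2)).Nonempty := by
  induction s using Finset.induction_on with
  | empty => exact ⟨N, G, id, hG, fun x y h => ⟨h, rfl⟩, by simp⟩
  | insert q s _ ih =>
    obtain ⟨M, G', ι, hG', hι, hs⟩ := ih
    by_cases hq : G.und.Adj q.1 q.2
    swap
    · refine ⟨M, G', ι, hG', hι, fun p hp hadj => ?_⟩
      obtain rfl | hp := Finset.mem_insert.1 hp
      exacts [absurd hadj hq, hs p hp hadj]
    have hadj := (hι _ _ hq).1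
    refine ⟨M + 1, G'.addNbr (ι q.1) (ι q.2) hα hβ, fun x => (ι x).castSucc,
      hG'.addVertex hadj, fun x y h => by simpa [addNbr] using hι x y h, fun p hp h => ?_⟩
    obtain rfl | hp := Finset.mem_insert.1 hp
    · exact ⟨Fin.last M, by simp [nbr, addNbr, hadj.ne']⟩
    · obtain ⟨w, hw⟩ := hs p hp h
      exact ⟨w.castSucc, by simpa [nbr, addNbr] using hw⟩

end NMGraph

/-- Every minimal `(n,m)`-universal bound of the family of partial 2-trees has
property `P_{2,1}`. -/
theorem minUnivBoundT2_hasP21 (n m : ℕ) (hnm : (n, m) ≠ (0, 1))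
    {W : Type} [Fintype W] (T : NMGraph n m W)
    (hT : IsMinUnivBoundT2 n m T) :
    HasP21 n m T := by
  intro u v huv α β hα₁ hα₂ hβ₁ hβ₂
  by_contra hempty
  refine hT.2 Set.univ (T.und.deleteEdges {s(u, v)}) (SimpleGraph.deleteEdges_le _)
    (Or.inr fun h => ?_) fun N G hG => ?_
  · rw [← h] at huv
    simp at huv
  obtain ⟨M, G', ι, hG', hι, hnbr⟩ :=
    G.exists_extension hG ⟨hα₁, hα₂⟩ ⟨hβ₁, hβ₂⟩ Finset.univ
  obtain ⟨f, hf⟩ := hT.1 M G' hG'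
  have hne (x y : Fin N) (h : G.und.Adj x y) : ¬(f (ι x) = u ∧ f (ι y) = v) := by
    rintro ⟨rfl, rfl⟩
    obtain ⟨w, ⟨hxw, hα⟩, hyw, hβ⟩ := hnbr (x, y) (Finset.mem_univ _) h
    have hx := hf _ _ hxw
    have hy := hf _ _ hyw
    exact hempty ⟨f w, ⟨hx.1, hx.2.trans hα⟩, hy.1, hy.2.trans hβ⟩
  refine ⟨fun x => ⟨f (ι x), trivial⟩, fun x y h => ?_⟩
  obtain ⟨hadj, hlab⟩ := hι x y h
  obtain ⟨hadj', hlab'⟩ := hf _ _ hadj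
  refine ⟨?_, hlab'.trans hlab⟩
  have h₁ := hne x y h
  have h₂ := hne y x h.symm
  simp only [NMGraph.restrict, SimpleGraph.comap_adj, SimpleGraph.deleteEdges_adj,
    Set.mem_singleton_iff, Sym2.eq_iff]
  tauto
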